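/- Let N ≥ 2, T > 0, α > 0, and let f : ℝ^N × (0,T) → ℝ be non-negative, bounded and measurable. Write x = (x₁, x′) ∈ ℝ × ℝ^{N−1}. Let s_{0±} : ℝ^{N−1} → ℝ be C² with bounded derivatives up to second order and s_{0−} < s_{0+} on ℝ^{N−1}. Then there exists no triple (u, s_−, s_+), where s_± : (0,T) × ℝ^{N−1} → ℝ are C¹ in t and C² in x′, s_− < s_+, converge to s_{0±} in the uniform C² topology as t ↓ 0, with s_±, ∇_{x′}s_±, ∇²_{x′}s_± bounded on ℝ^{N−1}×(0,T) and ṡ_± bounded on ℝ^{N−1}×(δ,T) for each δ > 0, and where u is a non-negative bounded classical solution of ∂_t u − Δu = f on the moving slab D(t) = {(x₁,x′) : s_−(t,x′) < x₁ < s_+(t,x′)}, continuous together with ∇u up to the lateral boundary, satisfying u = 0 and ∂u/∂ν = −α on both boundary graphs x₁ = s_±(t,x′), continuous up to t = 0 with u(·,0) ≡ 0. -/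

import Mathlib

set_option autoImplicit false
open Set Filter

lemma slab_second_deriv (h h' : ℝ → ℝ) (d x : ℝ) (hm : IsLocalMax h x)
    (h1 : ∀ᶠ y in nhds x, HasDerivAt h (h' y) y) (h2 : HasDerivAt h' d x) : d ≤ 0 := by
  by_contra hd
  push Not at hd
  have e1 : deriv h =ᶠ[nhds x] h' := h1.mono fun y hy => hy.deriv
  have e2 : deriv (deriv h) x = d := by rw [e1.deriv_eq, h2.deriv]
  have hx := h1.self_of_nhds
  have hmin := isLocalMin_of_deriv_deriv_pos (by rw [e2]; exact hd) hm.deriv_eq_zero hx.continuousAt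
  have e3 : h =ᶠ[nhds x] fun _ => h x := by
    filter_upwards [hm, hmin] with y a b using le_antisymm a b
  have e4 : deriv h =ᶠ[nhds x] deriv (fun _ => h x) := e3.deriv
  have e5 := e4.deriv_eq
  simp at e5
  rw [e5] at e2
  linarith

lemma slab_lower (F F' : ℝ → ℝ) (p q : ℝ) (hpq : p < q) (hc : ContinuousOn F (Icc p q))
    (hd : ∀ x ∈ Ioo p q, HasDerivAt F (F' x) x) (hc' : ContinuousWithinAt F' (Icc p q) p)
    (hp : 0 < F' p) : ∃ x ∈ Ioo p q, F p < F x := by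
  have h1 : ∀ᶠ x in nhdsWithin p (Icc p q), 0 < F' x := hc'.eventually (lt_mem_nhds hp)
  rw [eventually_nhdsWithin_iff, Metric.eventually_nhds_iff] at h1
  obtain ⟨e, he, h1⟩ := h1
  have hr : 0 < min (e/2) ((q-p)/2) := lt_min (by linarith) (by linarith)
  set r := min (e/2) ((q-p)/2) with hrd
  have hr1 : r ≤ e/2 := min_le_left _ _
  have hr2 : r ≤ (q-p)/2 := min_le_right _ _
  refine ⟨p + r, ⟨by linarith, by linarith⟩, ?_⟩
  obtain ⟨c, hcm, hc2⟩ := exists_hasDerivAt_eq_slope F F' (show p < p + r by linarith)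
    (hc.mono (Icc_subset_Icc le_rfl (by linarith)))
    (fun x hx => hd x ⟨hx.1, by linarith [hx.2]⟩)
  have h2 : 0 < F' c := h1 (by rw [Real.dist_eq, abs_lt]; constructor <;> linarith [hcm.1, hcm.2])
    ⟨hcm.1.le, by linarith [hcm.2]⟩
  rw [hc2] at h2
  have h3 := (div_pos_iff_of_pos_right (show 0 < p + r - p by linarith)).1 h2
  linarith

lemma slab_upper (F F' : ℝ → ℝ) (p q : ℝ) (hpq : p < q) (hc : ContinuousOn F (Icc p q))
    (hd : ∀ x ∈ Ioo p q, HasDerivAt F (F' x) x) (hc' : ContinuousWithinAt F' (Icc p q) q)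
    (hp : F' q < 0) : ∃ x ∈ Ioo p q, F q < F x := by
  have hmap : MapsTo (fun x : ℝ => -x) (Icc (-q) (-p)) (Icc p q) := fun x hx =>
    ⟨by linarith [hx.2], by linarith [hx.1]⟩
  obtain ⟨x, hx, hlt⟩ := slab_lower (fun x => F (-x)) (fun x => - F' (-x)) (-q) (-p) (by linarith)
    (hc.comp (by fun_prop) hmap)
    (fun x hx => by
      have := (hd (-x) ⟨by linarith [hx.2], by linarith [hx.1]⟩).comp x (hasDerivAt_neg x)
      simpa [Function.comp_def] using this)
    (by
      have h0 : ContinuousWithinAt F' (Icc p q) (- -q) := by simpa using hc'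
      have := ContinuousWithinAt.comp (f := fun x : ℝ => -x) (x := -q) h0 (by fun_prop) hmap
      exact this.neg)
    (by simpa using hp)
  exact ⟨-x, ⟨by linarith [hx.2], by linarith [hx.1]⟩, by simpa using hlt⟩

lemma slab_time (h : ℝ → ℝ) (d t : ℝ) (hd : HasDerivAt h d t)
    (hm : ∀ᶠ y in nhdsWithin t (Iio t), h y ≤ h t) : 0 ≤ d := by
  have h1 := (hasDerivWithinAt_iff_tendsto_slope' (s := Iio t) (by simp)).1 hd.hasDerivWithinAt
  refine ge_of_tendsto h1 ?_
  filter_upwards [hm, self_mem_nhdsWithin] with y hy hy2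
  rw [slope_def_field]
  exact div_nonneg_of_nonpos (by linarith) (by linarith [show y < t from hy2])

/-- The penalised barrier. -/
noncomputable def slabW (n : ℕ) (A B C V m η a : ℝ) (x₁ : ℝ) (x : EuclideanSpace ℝ (Fin n))
    (t : ℝ) : ℝ :=
  A + B * (t - a) - C * Real.exp (-V * (x₁ - V * t + ‖x‖ ^ 2 - m))
    + η * (‖x‖ ^ 2 + (2 * n + 1) * (t - a))

lemma slabW_cont (n : ℕ) (A B C V m η a : ℝ) :
    Continuous fun p : ℝ × EuclideanSpace ℝ (Fin n) × ℝ =>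
      slabW n A B C V m η a p.1 p.2.1 p.2.2 := by
  unfold slabW; fun_prop

lemma slabW_d1 (n : ℕ) (A B C V m η a : ℝ) (x₁ : ℝ) (x : EuclideanSpace ℝ (Fin n)) (t : ℝ) :
    HasDerivAt (fun ξ => slabW n A B C V m η a ξ x t)
      (C * V * Real.exp (-V * (x₁ - V * t + ‖x‖ ^ 2 - m))) x₁ := by
  unfold slabW
  have h : HasDerivAt (fun ξ : ℝ => -V * (ξ - V * t + ‖x‖ ^ 2 - m)) (-V * 1) x₁ :=
    ((((hasDerivAt_id x₁).sub_const _).add_const _).sub_const _).const_mul _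
  have := (((h.exp.const_mul C).const_sub (A + B * (t - a))).add_const
    (η * (‖x‖ ^ 2 + (2 * n + 1) * (t - a))))
  refine HasDerivAt.congr_deriv this ?_
  ring

lemma slabW_d11 (n : ℕ) (C V m : ℝ) (x₁ : ℝ) (x : EuclideanSpace ℝ (Fin n)) (t : ℝ) :
    HasDerivAt (fun ξ => C * V * Real.exp (-V * (ξ - V * t + ‖x‖ ^ 2 - m)))
      (-(C * V ^ 2 * Real.exp (-V * (x₁ - V * t + ‖x‖ ^ 2 - m)))) x₁ := by
  have h : HasDerivAt (fun ξ : ℝ => -V * (ξ - V * t + ‖x‖ ^ 2 - m)) (-V * 1) x₁ :=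
    ((((hasDerivAt_id x₁).sub_const _).add_const _).sub_const _).const_mul _
  have := h.exp.const_mul (C * V)
  refine HasDerivAt.congr_deriv this ?_
  ring

lemma slabW_dt (n : ℕ) (A B C V m η a : ℝ) (x₁ : ℝ) (x : EuclideanSpace ℝ (Fin n)) (t : ℝ) :
    HasDerivAt (fun τ => slabW n A B C V m η a x₁ x τ)
      (B - C * V ^ 2 * Real.exp (-V * (x₁ - V * t + ‖x‖ ^ 2 - m)) + η * (2 * n + 1)) t := by
  unfold slabW
  have h : HasDerivAt (fun τ : ℝ => -V * (x₁ - V * τ + ‖x‖ ^ 2 - m)) (-V * -(V * 1)) t :=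
    (((((hasDerivAt_id t).const_mul V).const_sub _).add_const _).sub_const _).const_mul _
  have h2 : HasDerivAt (fun τ : ℝ => A + B * (τ - a)) (B * 1) t :=
    (((hasDerivAt_id t).sub_const _).const_mul _).const_add _
  have h3 : HasDerivAt (fun τ : ℝ => η * (‖x‖ ^ 2 + (2 * n + 1) * (τ - a)))
      (η * ((2 * n + 1) * 1)) t :=
    ((((hasDerivAt_id t).sub_const _).const_mul _).const_add _).const_mul _
  have := (h2.sub (h.exp.const_mul C)).add h3
  refine HasDerivAt.congr_deriv this ?_
  ring

lemma slab_norm_sq (n : ℕ) (x : EuclideanSpace ℝ (Fin n)) (i : Fin n) (h : ℝ) :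
    ‖x + h • EuclideanSpace.single i (1 : ℝ)‖ ^ 2 = ‖x‖ ^ 2 + 2 * h * x i + h ^ 2 := by
  rw [norm_add_sq_real, norm_smul, inner_smul_right, real_inner_comm, EuclideanSpace.inner_single_left]
  simp
  ring

lemma slabW_dx (n : ℕ) (A B C V m η a : ℝ) (x₁ : ℝ) (x : EuclideanSpace ℝ (Fin n)) (t : ℝ)
    (i : Fin n) (h : ℝ) :
    HasDerivAt (fun k : ℝ => slabW n A B C V m η a x₁ (x + k • EuclideanSpace.single i (1 : ℝ)) t)
      ((2 * x i + 2 * h) * (η + C * V *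
        Real.exp (-V * (x₁ - V * t + (‖x‖ ^ 2 + 2 * h * x i + h ^ 2) - m)))) h := by
  unfold slabW
  simp only [slab_norm_sq]
  have h0 : HasDerivAt (fun k : ℝ => ‖x‖ ^ 2 + 2 * k * x i + k ^ 2) (2 * x i + 2 * h) h := by
    have h1 : HasDerivAt (fun k : ℝ => 2 * k * x i) (2 * 1 * x i) h :=
      ((hasDerivAt_id h).const_mul 2).mul_const _
    have := (h1.const_add (‖x‖ ^ 2)).add (hasDerivAt_pow 2 h)
    refine HasDerivAt.congr_deriv this ?_
    simp
  have h1 : HasDerivAt (fun k : ℝ => -V * (x₁ - V * t + (‖x‖ ^ 2 + 2 * k * x i + k ^ 2) - m))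
    (-V * (2 * x i + 2 * h)) h := ((h0.const_add _).sub_const _).const_mul _
  have := ((h1.exp.const_mul C).const_sub (A + B * (t - a))).add
    ((h0.add_const ((2 * n + 1) * (t - a))).const_mul η)
  refine HasDerivAt.congr_deriv this ?_
  ring

lemma slabW_dxx (n : ℕ) (C V m η : ℝ) (x₁ : ℝ) (x : EuclideanSpace ℝ (Fin n)) (t : ℝ)
    (i : Fin n) :
    HasDerivAt (fun h : ℝ => (2 * x i + 2 * h) * (η + C * V *
        Real.exp (-V * (x₁ - V * t + (‖x‖ ^ 2 + 2 * h * x i + h ^ 2) - m))))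
      (2 * η + C * V * Real.exp (-V * (x₁ - V * t + ‖x‖ ^ 2 - m)) * (2 - 4 * V * x i ^ 2)) 0 := by
  have h0 : HasDerivAt (fun k : ℝ => ‖x‖ ^ 2 + 2 * k * x i + k ^ 2) (2 * x i) 0 := by
    have h1 : HasDerivAt (fun k : ℝ => 2 * k * x i) (2 * 1 * x i) 0 :=
      ((hasDerivAt_id 0).const_mul 2).mul_const _
    have := (h1.const_add (‖x‖ ^ 2)).add (hasDerivAt_pow 2 (0 : ℝ))
    refine HasDerivAt.congr_deriv this ?_
    simp
  have h1 : HasDerivAt (fun k : ℝ => -V * (x₁ - V * t + (‖x‖ ^ 2 + 2 * k * x i + k ^ 2) - m))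
    (-V * (2 * x i)) 0 := ((h0.const_add _).sub_const _).const_mul _
  have h2 : HasDerivAt (fun h : ℝ => 2 * x i + 2 * h) (2 * 1) 0 :=
    ((hasDerivAt_id 0).const_mul 2).const_add _
  have := h2.mul ((h1.exp.const_mul (C * V)).const_add η)
  refine HasDerivAt.congr_deriv this ?_
  simp
  ring

lemma slab_mp_eta (n : ℕ) (T a b M Mu κ A B C V m η : ℝ) (ha : 0 ≤ a) (hb : b < T)
    (hη : 0 < η)
    (f u u₁ u₁₁ : ℝ → EuclideanSpace ℝ (Fin n) → ℝ → ℝ)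
    (sm sp : ℝ → EuclideanSpace ℝ (Fin n) → ℝ)
    (Du' : ℝ → EuclideanSpace ℝ (Fin n) → ℝ → (EuclideanSpace ℝ (Fin n) →L[ℝ] ℝ))
    (D2u' : ℝ → EuclideanSpace ℝ (Fin n) → ℝ →
          (EuclideanSpace ℝ (Fin n) →L[ℝ] EuclideanSpace ℝ (Fin n) →L[ℝ] ℝ))
    (hf : ∀ (x₁ : ℝ) (x' : EuclideanSpace ℝ (Fin n)), ∀ t ∈ Ioo 0 T, f x₁ x' t ≤ M)
    (hsm : ContinuousOn (fun q : EuclideanSpace ℝ (Fin n) × ℝ => sm q.2 q.1) (univ ×ˢ Ico 0 T))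
    (hsp : ContinuousOn (fun q : EuclideanSpace ℝ (Fin n) × ℝ => sp q.2 q.1) (univ ×ˢ Ico 0 T))
    (hlt : ∀ t ∈ Ioo 0 T, ∀ x', sm t x' < sp t x')
    (hbm : ∃ Ms : ℝ, ∀ t ∈ Icc a b, ∀ x', |sm t x'| ≤ Ms ∧ |sp t x'| ≤ Ms)
    (hsol : ∀ t ∈ Ioo 0 T, ∀ x' : EuclideanSpace ℝ (Fin n), ∀ x₁ : ℝ,
        sm t x' < x₁ → x₁ < sp t x' →
        HasDerivAt (fun ξ => u ξ x' t) (u₁ x₁ x' t) x₁ ∧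
        HasDerivAt (fun ξ => u₁ ξ x' t) (u₁₁ x₁ x' t) x₁ ∧
        HasFDerivAt (fun y => u x₁ y t) (Du' x₁ x' t) x' ∧
        HasFDerivAt (fun y => Du' x₁ y t) (D2u' x₁ x' t) x' ∧
        HasDerivAt (fun τ => u x₁ x' τ)
          (u₁₁ x₁ x' t +
            (∑ i : Fin n,
              D2u' x₁ x' t (EuclideanSpace.single i (1 : ℝ))
                (EuclideanSpace.single i (1 : ℝ))) + f x₁ x' t) t)
    (hMu : ∀ t ∈ Icc a b, ∀ x' : EuclideanSpace ℝ (Fin n), ∀ x₁ : ℝ,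
        sm t x' ≤ x₁ → x₁ ≤ sp t x' → u x₁ x' t ≤ Mu)
    (hu : ContinuousOn (fun p : ℝ × EuclideanSpace ℝ (Fin n) × ℝ => u p.1 p.2.1 p.2.2)
        {p : ℝ × EuclideanSpace ℝ (Fin n) × ℝ |
          p.2.2 ∈ Ico 0 T ∧ sm p.2.2 p.2.1 ≤ p.1 ∧ p.1 ≤ sp p.2.2 p.2.1})
    (hu₁ : ContinuousOn (fun p : ℝ × EuclideanSpace ℝ (Fin n) × ℝ => u₁ p.1 p.2.1 p.2.2)
        {p : ℝ × EuclideanSpace ℝ (Fin n) × ℝ |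
          p.2.2 ∈ Ioo 0 T ∧ sm p.2.2 p.2.1 ≤ p.1 ∧ p.1 ≤ sp p.2.2 p.2.1})
    (hlow : ∀ t ∈ Ioo 0 T, ∀ x', κ < u₁ (sm t x') x' t)
    (hup : ∀ t ∈ Ioo 0 T, ∀ x', u₁ (sp t x') x' t < 0)
    (hC : 0 ≤ C) (hV : 0 ≤ V) (hCV : C * V ≤ κ) (hB0 : 0 ≤ B) (hB : M + 2 * n * (C * V) ≤ B)
    (hθ : ∀ t ∈ Icc a b, ∀ x', m ≤ sm t x' + ‖x'‖ ^ 2 - V * t)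
    (hini : ∀ (x' : EuclideanSpace ℝ (Fin n)) (x₁ : ℝ), sm a x' ≤ x₁ → x₁ ≤ sp a x' →
      u x₁ x' a ≤ A - C * Real.exp (-V * (x₁ - V * a + ‖x'‖ ^ 2 - m))) :
    ∀ t ∈ Icc a b, ∀ (x' : EuclideanSpace ℝ (Fin n)) (x₁ : ℝ), sm t x' ≤ x₁ → x₁ ≤ sp t x' →
      u x₁ x' t ≤ slabW n A B C V m η a x₁ x' t := by
  intro t ht x x₁ hx1 hx2
  by_contra hcon
  push Not at hcon
  obtain ⟨Ms, hMs⟩ := hbm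
  have hE : ∀ t ∈ Icc a b, ∀ (x' : EuclideanSpace ℝ (Fin n)) (x₁ : ℝ), sm t x' ≤ x₁ →
      Real.exp (-V * (x₁ - V * t + ‖x'‖ ^ 2 - m)) ≤ 1 := by
    intro t ht x' x₁ hx
    rw [Real.exp_le_one_iff]
    have := hθ t ht x'
    have h3 : 0 ≤ V * (x₁ - V * t + ‖x'‖ ^ 2 - m) := mul_nonneg hV (by linarith)
    linarith
  -- radius
  obtain ⟨R, hRx, hR⟩ : ∃ R : ℝ, ‖x‖ ≤ R ∧ Mu < A - C + η * R ^ 2 := by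
    refine ⟨‖x‖ + (|Mu - A + C| / η + 1), by have := abs_nonneg (Mu - A + C); linarith [div_nonneg this hη.le], ?_⟩
    have h0 : 0 ≤ |Mu - A + C| / η := by positivity
    have h1 : |Mu - A + C| / η + 1 ≤ (‖x‖ + (|Mu - A + C| / η + 1)) ^ 2 := by
      nlinarith [norm_nonneg x]
    have h2 := mul_le_mul_of_nonneg_left h1 hη.le
    have h3 : η * (|Mu - A + C| / η + 1) = |Mu - A + C| + η := by field_simp
    linarith [le_abs_self (Mu - A + C)]
  set K : Set (ℝ × EuclideanSpace ℝ (Fin n) × ℝ) :=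
    {p | p.2.2 ∈ Icc a b ∧ ‖p.2.1‖ ≤ R ∧ sm p.2.2 p.2.1 ≤ p.1 ∧ p.1 ≤ sp p.2.2 p.2.1} with hK
  have hIco : ∀ t ∈ Icc a b, t ∈ Ico 0 T := fun t ht => ⟨by linarith [ht.1], by linarith [ht.2]⟩
  have hKc : IsCompact K := by
    have hS : IsCompact ((Icc (-Ms) Ms) ×ˢ (Metric.closedBall (0 : EuclideanSpace ℝ (Fin n)) R) ×ˢ
      (Icc a b)) := isCompact_Icc.prod ((isCompact_closedBall _ _).prod isCompact_Icc)
    have hmap : MapsTo (fun p : ℝ × EuclideanSpace ℝ (Fin n) × ℝ => p.2)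
      ((Icc (-Ms) Ms) ×ˢ (Metric.closedBall (0 : EuclideanSpace ℝ (Fin n)) R) ×ˢ
      (Icc a b)) (univ ×ˢ Ico 0 T) := fun p hp => ⟨mem_univ _, hIco _ hp.2.2⟩
    have c1 := hsm.comp (t := univ ×ˢ Ico 0 T) (f := fun p : ℝ × EuclideanSpace ℝ (Fin n) × ℝ => p.2)
      (by fun_prop) hmap
    have c2 := hsp.comp (t := univ ×ˢ Ico 0 T) (f := fun p : ℝ × EuclideanSpace ℝ (Fin n) × ℝ => p.2)
      (by fun_prop) hmap
    have l1 := hS.isClosed.isClosed_le c1 continuous_fst.continuousOn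
    have l2 := hS.isClosed.isClosed_le continuous_fst.continuousOn c2
    refine IsCompact.of_isClosed_subset (t := K) hS ?_ ?_
    · convert l1.inter l2 using 1
      ext p
      simp only [hK, mem_ofPred_eq, mem_inter_iff, mem_prod, mem_closedBall_zero_iff,
        Function.comp_def]
      constructor
      · rintro ⟨h1, h2, h3, h4⟩
        have := hMs _ h1 p.2.1
        have e1 := abs_le.1 this.1
        have e2 := abs_le.1 this.2
        have e3 : p.1 ∈ Icc (-Ms) Ms := ⟨by linarith, by linarith⟩
        exact ⟨⟨⟨e3, h2, h1⟩, h3⟩, ⟨⟨e3, h2, h1⟩, h4⟩⟩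
      · rintro ⟨⟨⟨e3, h2, h1⟩, h3⟩, ⟨_, h4⟩⟩
        exact ⟨h1, h2, h3, h4⟩
    · rintro p ⟨h1, h2, h3, h4⟩
      have := hMs _ h1 p.2.1
      have e1 := abs_le.1 this.1
      have e2 := abs_le.1 this.2
      exact ⟨⟨by linarith, by linarith⟩, by simpa using h2, h1⟩
  set g : ℝ × EuclideanSpace ℝ (Fin n) × ℝ → ℝ := fun p =>
    u p.1 p.2.1 p.2.2 - slabW n A B C V m η a p.1 p.2.1 p.2.2 with hg
  have hgc : ContinuousOn g K := by
    refine ContinuousOn.sub (hu.mono ?_) (slabW_cont n A B C V m η a).continuousOn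
    rintro p ⟨h1, h2, h3, h4⟩
    exact ⟨hIco _ h1, h3, h4⟩
  have hP : (x₁, x, t) ∈ K := ⟨ht, hRx, hx1, hx2⟩
  obtain ⟨⟨y₁, y, s⟩, hQ, hmax⟩ := hKc.exists_isMaxOn ⟨_, hP⟩ hgc
  have hgQ : 0 < u y₁ y s - slabW n A B C V m η a y₁ y s := by
    have : g (x₁, x, t) ≤ g (y₁, y, s) := hmax hP
    simp only [hg] at this
    linarith
  obtain ⟨hs, hyR, hy1, hy2⟩ := hQ
  simp only at hs hyR hy1 hy2
  have hmax' : ∀ z₁ z r, r ∈ Icc a b → ‖z‖ ≤ R → sm r z ≤ z₁ → z₁ ≤ sp r z →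
      u z₁ z r - slabW n A B C V m η a z₁ z r ≤ u y₁ y s - slabW n A B C V m η a y₁ y s := by
    intro z₁ z r h1 h2 h3 h4
    exact hmax (show (z₁, z, r) ∈ K from ⟨h1, h2, h3, h4⟩)
  have hEy := hE s hs y y₁ hy1
  have hEy0 := Real.exp_pos (-V * (y₁ - V * s + ‖y‖ ^ 2 - m))
  have hyR' : ‖y‖ < R := by
    refine lt_of_le_of_ne hyR fun h => ?_
    have h1 := hMu s hs y y₁ hy1 hy2
    unfold slabW at hgQ
    rw [h] at hgQ hEy
    have h2 : C * Real.exp (-V * (y₁ - V * s + R ^ 2 - m)) ≤ C * 1 :=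
      mul_le_mul_of_nonneg_left hEy hC
    have h3 : 0 ≤ B * (s - a) := mul_nonneg hB0 (by linarith [hs.1])
    have h4 : 0 ≤ η * ((2 * n + 1) * (s - a)) :=
      mul_nonneg hη.le (mul_nonneg (by positivity) (by linarith [hs.1]))
    linarith
  have has : a < s := by
    refine lt_of_le_of_ne hs.1 fun h => ?_
    subst h
    have h1 := hini y y₁ hy1 hy2
    unfold slabW at hgQ
    have h2 : 0 ≤ η * ‖y‖ ^ 2 := by positivity
    simp only [sub_self, mul_zero, add_zero] at hgQ
    linarith
  have hs' : s ∈ Ioo 0 T := ⟨by linarith, by linarith [hs.2]⟩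
  have hslt := hlt s hs' y
  -- sections in the first variable
  have hmapx : MapsTo (fun ξ : ℝ => ((ξ, y, s) : ℝ × EuclideanSpace ℝ (Fin n) × ℝ))
      (Icc (sm s y) (sp s y)) {p : ℝ × EuclideanSpace ℝ (Fin n) × ℝ |
          p.2.2 ∈ Ioo 0 T ∧ sm p.2.2 p.2.1 ≤ p.1 ∧ p.1 ≤ sp p.2.2 p.2.1} :=
    fun ξ hξ => ⟨hs', hξ.1, hξ.2⟩
  have hF : ContinuousOn (fun ξ => u ξ y s - slabW n A B C V m η a ξ y s)
      (Icc (sm s y) (sp s y)) := by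
    refine ContinuousOn.sub (hu.comp (f := fun ξ : ℝ => ((ξ, y, s) : ℝ × EuclideanSpace ℝ (Fin n) × ℝ)) (by fun_prop) ?_) ?_
    · intro ξ hξ
      exact ⟨hIco _ hs, hξ.1, hξ.2⟩
    · exact fun ξ _ => (slabW_d1 n A B C V m η a ξ y s).continuousAt.continuousWithinAt
  have hF' : ContinuousOn (fun ξ => u₁ ξ y s -
      C * V * Real.exp (-V * (ξ - V * s + ‖y‖ ^ 2 - m))) (Icc (sm s y) (sp s y)) := by
    refine ContinuousOn.sub (hu₁.comp (f := fun ξ : ℝ => ((ξ, y, s) : ℝ × EuclideanSpace ℝ (Fin n) × ℝ)) (by fun_prop) hmapx) ?_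
    fun_prop
  have hFd : ∀ ξ ∈ Ioo (sm s y) (sp s y), HasDerivAt
      (fun ξ => u ξ y s - slabW n A B C V m η a ξ y s)
      (u₁ ξ y s - C * V * Real.exp (-V * (ξ - V * s + ‖y‖ ^ 2 - m))) ξ := fun ξ hξ =>
    (hsol s hs' y ξ hξ.1 hξ.2).1.sub (slabW_d1 n A B C V m η a ξ y s)
  have hCV0 : 0 ≤ C * V := mul_nonneg hC hV
  have hy1' : sm s y < y₁ := by
    refine lt_of_le_of_ne hy1 fun h => ?_
    obtain ⟨ξ, hξ, hlt2⟩ := slab_lower _ _ _ _ hslt hF hFd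
      (hF' _ (left_mem_Icc.2 hslt.le)) (by
        have h1 := hlow s hs' y
        have h2 := mul_le_mul_of_nonneg_left (hE s hs y (sm s y) le_rfl) hCV0
        linarith)
    have := hmax' ξ y s hs hyR hξ.1.le hξ.2.le
    rw [← h] at this
    linarith
  have hy2' : y₁ < sp s y := by
    refine lt_of_le_of_ne hy2 fun h => ?_
    obtain ⟨ξ, hξ, hlt2⟩ := slab_upper _ _ _ _ hslt hF hFd
      (hF' _ (right_mem_Icc.2 hslt.le)) (by
        have h1 := hup s hs' y
        have h2 := mul_nonneg hCV0 (Real.exp_pos (-V * (sp s y - V * s + ‖y‖ ^ 2 - m))).le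
        linarith)
    have := hmax' ξ y s hs hyR hξ.1.le hξ.2.le
    rw [h] at this
    linarith
  obtain ⟨-, d11, -, d2, dt⟩ := hsol s hs' y y₁ hy1' hy2'
  -- second derivative in x₁
  have I1 : u₁₁ y₁ y s - -(C * V ^ 2 * Real.exp (-V * (y₁ - V * s + ‖y‖ ^ 2 - m))) ≤ 0 := by
    refine slab_second_deriv (fun ξ => u ξ y s - slabW n A B C V m η a ξ y s) _ _ y₁ ?_ ?_
      (d11.sub (slabW_d11 n C V m y₁ y s))
    · filter_upwards [Ioo_mem_nhds hy1' hy2'] with ξ hξ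
      exact hmax' ξ y s hs hyR hξ.1.le hξ.2.le
    · filter_upwards [Ioo_mem_nhds hy1' hy2'] with ξ hξ using hFd ξ hξ
  -- openness of the slab
  have hopen : ∀ᶠ q : EuclideanSpace ℝ (Fin n) × ℝ in nhds (y, s),
      sm q.2 q.1 < y₁ ∧ y₁ < sp q.2 q.1 := by
    have hn : (univ : Set (EuclideanSpace ℝ (Fin n))) ×ˢ Ico 0 T ∈ nhds (y, s) :=
      prod_mem_nhds univ_mem (Ico_mem_nhds hs'.1 hs'.2)
    exact ((hsm.continuousAt hn).eventually (gt_mem_nhds hy1')).and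
      ((hsp.continuousAt hn).eventually (lt_mem_nhds hy2'))
  -- second derivatives in x'
  have I2 : ∀ i : Fin n, D2u' y₁ y s (EuclideanSpace.single i (1 : ℝ))
      (EuclideanSpace.single i (1 : ℝ)) ≤ 2 * η +
        C * V * Real.exp (-V * (y₁ - V * s + ‖y‖ ^ 2 - m)) * (2 - 4 * V * y i ^ 2) := by
    intro i
    set e : EuclideanSpace ℝ (Fin n) := EuclideanSpace.single i (1 : ℝ) with he
    have hline : ∀ h : ℝ, HasDerivAt (fun k : ℝ => y + k • e) e h := by
      intro h
      simpa using ((hasDerivAt_id h).smul_const e).const_add y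
    have hline0 : Tendsto (fun k : ℝ => y + k • e) (nhds 0) (nhds y) := by
      have := (hline 0).continuousAt.tendsto
      simpa using this
    have hnear : ∀ᶠ h : ℝ in nhds 0, ‖y + h • e‖ < R ∧ sm s (y + h • e) < y₁ ∧
        y₁ < sp s (y + h • e) := by
      have t2 : Tendsto (fun k : ℝ => (y + k • e, s)) (nhds 0) (nhds (y, s)) :=
        hline0.prodMk_nhds tendsto_const_nhds
      exact (hline0.norm.eventually (gt_mem_nhds hyR')).and (t2.eventually hopen)
    have hd2 : HasDerivAt (fun h : ℝ => Du' y₁ (y + h • e) s e) (D2u' y₁ y s e e) 0 := by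
      have h1 : HasFDerivAt (fun z => Du' y₁ z s) (D2u' y₁ y s) (y + (0 : ℝ) • e) := by
        simpa using d2
      have h2 := h1.comp_hasDerivAt (0 : ℝ) (hline 0)
      have h3 := h2.clm_apply (hasDerivAt_const (0 : ℝ) e)
      simpa [Function.comp_def] using h3
    have := slab_second_deriv
      (fun h => u y₁ (y + h • e) s - slabW n A B C V m η a y₁ (y + h • e) s) _ _ 0 ?_ ?_
      (hd2.sub (slabW_dxx n C V m η y₁ y s i))
    · linarith
    · filter_upwards [hnear] with h hh
      have := hmax' y₁ (y + h • e) s hs hh.1.le hh.2.1.le hh.2.2.le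
      simpa using this
    · filter_upwards [hnear] with h hh
      exact ((hsol s hs' (y + h • e) y₁ hh.2.1 hh.2.2).2.2.1.comp_hasDerivAt h (hline h)).sub
        (slabW_dx n A B C V m η a y₁ y s i h)
  have I3 := slab_time _ _ s (dt.sub (slabW_dt n A B C V m η a y₁ y s)) (by
    have t2 : Tendsto (fun r : ℝ => (y, r)) (nhdsWithin s (Iio s)) (nhds (y, s)) :=
      tendsto_const_nhds.prodMk_nhds (tendsto_id.mono_left nhdsWithin_le_nhds)
    filter_upwards [t2.eventually hopen, Ioo_mem_nhdsLT has] with r hr hr2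
    exact hmax' y₁ y r ⟨hr2.1.le, by linarith [hr2.2, hs.2]⟩ hyR hr.1.le hr.2.le)
  have I4 := Finset.sum_le_sum fun i (_ : i ∈ Finset.univ) => I2 i
  have I5 := hf y₁ y s hs'
  set E := Real.exp (-V * (y₁ - V * s + ‖y‖ ^ 2 - m)) with hEd
  have I6 : ∑ i : Fin n, (2 * η + C * V * E * (2 - 4 * V * y i ^ 2)) ≤
      n * (2 * η + C * V * E * 2) := by
    have : ∑ i : Fin n, (2 * η + C * V * E * 2) = n * (2 * η + C * V * E * 2) := by
      rw [Finset.sum_const, Finset.card_univ, Fintype.card_fin, nsmul_eq_mul]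
    rw [← this]
    refine Finset.sum_le_sum fun i _ => ?_
    have h1 : 0 ≤ C * V * E * (4 * V * y i ^ 2) := by positivity
    linarith
  have I7 : n * (C * V * E * 2) ≤ 2 * n * (C * V) := by
    have h1 : C * V * E ≤ C * V * 1 := mul_le_mul_of_nonneg_left hEy hCV0
    have h2 : (0 : ℝ) ≤ n := by positivity
    nlinarith
  nlinarith

lemma slab_mp (n : ℕ) (T a b M Mu κ A B C V m : ℝ) (ha : 0 ≤ a) (hb : b < T)
    (f u u₁ u₁₁ : ℝ → EuclideanSpace ℝ (Fin n) → ℝ → ℝ)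
    (sm sp : ℝ → EuclideanSpace ℝ (Fin n) → ℝ)
    (Du' : ℝ → EuclideanSpace ℝ (Fin n) → ℝ → (EuclideanSpace ℝ (Fin n) →L[ℝ] ℝ))
    (D2u' : ℝ → EuclideanSpace ℝ (Fin n) → ℝ →
          (EuclideanSpace ℝ (Fin n) →L[ℝ] EuclideanSpace ℝ (Fin n) →L[ℝ] ℝ))
    (hf : ∀ (x₁ : ℝ) (x' : EuclideanSpace ℝ (Fin n)), ∀ t ∈ Ioo 0 T, f x₁ x' t ≤ M)
    (hsm : ContinuousOn (fun q : EuclideanSpace ℝ (Fin n) × ℝ => sm q.2 q.1) (univ ×ˢ Ico 0 T))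
    (hsp : ContinuousOn (fun q : EuclideanSpace ℝ (Fin n) × ℝ => sp q.2 q.1) (univ ×ˢ Ico 0 T))
    (hlt : ∀ t ∈ Ioo 0 T, ∀ x', sm t x' < sp t x')
    (hbm : ∃ Ms : ℝ, ∀ t ∈ Icc a b, ∀ x', |sm t x'| ≤ Ms ∧ |sp t x'| ≤ Ms)
    (hsol : ∀ t ∈ Ioo 0 T, ∀ x' : EuclideanSpace ℝ (Fin n), ∀ x₁ : ℝ,
        sm t x' < x₁ → x₁ < sp t x' →
        HasDerivAt (fun ξ => u ξ x' t) (u₁ x₁ x' t) x₁ ∧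
        HasDerivAt (fun ξ => u₁ ξ x' t) (u₁₁ x₁ x' t) x₁ ∧
        HasFDerivAt (fun y => u x₁ y t) (Du' x₁ x' t) x' ∧
        HasFDerivAt (fun y => Du' x₁ y t) (D2u' x₁ x' t) x' ∧
        HasDerivAt (fun τ => u x₁ x' τ)
          (u₁₁ x₁ x' t +
            (∑ i : Fin n,
              D2u' x₁ x' t (EuclideanSpace.single i (1 : ℝ))
                (EuclideanSpace.single i (1 : ℝ))) + f x₁ x' t) t)
    (hMu : ∀ t ∈ Icc a b, ∀ x' : EuclideanSpace ℝ (Fin n), ∀ x₁ : ℝ,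
        sm t x' ≤ x₁ → x₁ ≤ sp t x' → u x₁ x' t ≤ Mu)
    (hu : ContinuousOn (fun p : ℝ × EuclideanSpace ℝ (Fin n) × ℝ => u p.1 p.2.1 p.2.2)
        {p : ℝ × EuclideanSpace ℝ (Fin n) × ℝ |
          p.2.2 ∈ Ico 0 T ∧ sm p.2.2 p.2.1 ≤ p.1 ∧ p.1 ≤ sp p.2.2 p.2.1})
    (hu₁ : ContinuousOn (fun p : ℝ × EuclideanSpace ℝ (Fin n) × ℝ => u₁ p.1 p.2.1 p.2.2)
        {p : ℝ × EuclideanSpace ℝ (Fin n) × ℝ |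
          p.2.2 ∈ Ioo 0 T ∧ sm p.2.2 p.2.1 ≤ p.1 ∧ p.1 ≤ sp p.2.2 p.2.1})
    (hlow : ∀ t ∈ Ioo 0 T, ∀ x', κ < u₁ (sm t x') x' t)
    (hup : ∀ t ∈ Ioo 0 T, ∀ x', u₁ (sp t x') x' t < 0)
    (hC : 0 ≤ C) (hV : 0 ≤ V) (hCV : C * V ≤ κ) (hB0 : 0 ≤ B) (hB : M + 2 * n * (C * V) ≤ B)
    (hθ : ∀ t ∈ Icc a b, ∀ x', m ≤ sm t x' + ‖x'‖ ^ 2 - V * t)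
    (hini : ∀ (x' : EuclideanSpace ℝ (Fin n)) (x₁ : ℝ), sm a x' ≤ x₁ → x₁ ≤ sp a x' →
      u x₁ x' a ≤ A - C * Real.exp (-V * (x₁ - V * a + ‖x'‖ ^ 2 - m))) :
    ∀ t ∈ Icc a b, ∀ (x' : EuclideanSpace ℝ (Fin n)) (x₁ : ℝ), sm t x' ≤ x₁ → x₁ ≤ sp t x' →
      u x₁ x' t ≤ A + B * (t - a) - C * Real.exp (-V * (x₁ - V * t + ‖x'‖ ^ 2 - m)) := by
  intro t ht x x₁ h1 h2
  set k : ℝ := ‖x‖ ^ 2 + (2 * n + 1) * (t - a) with hk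
  have hk0 : 0 ≤ k := add_nonneg (by positivity) (mul_nonneg (by positivity) (by linarith [ht.1]))
  refine le_of_forall_pos_le_add fun ε hε => ?_
  have := slab_mp_eta n T a b M Mu κ A B C V m (ε / (k + 1)) ha hb (by positivity)
    f u u₁ u₁₁ sm sp Du' D2u' hf hsm hsp hlt hbm hsol hMu hu hu₁ hlow hup hC hV hCV hB0 hB hθ hini
    t ht x x₁ h1 h2
  unfold slabW at this
  rw [← hk] at this
  have h3 : ε / (k + 1) * k ≤ ε := by
    rw [div_mul_eq_mul_div, div_le_iff₀ (by linarith)]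
    nlinarith
  linarith

lemma slab_graph_cont (n : ℕ) (T : ℝ) (s₀ : EuclideanSpace ℝ (Fin n) → ℝ)
    (s : ℝ → EuclideanSpace ℝ (Fin n) → ℝ) (h₀ : Differentiable ℝ s₀) (M₀ M : ℝ)
    (hM₀ : ∀ x, ‖fderiv ℝ s₀ x‖ ≤ M₀)
    (hd : ∀ t ∈ Ioo 0 T, Differentiable ℝ (fun x => s t x))
    (hM : ∀ t ∈ Ioo 0 T, ∀ x, ‖fderiv ℝ (fun y => s t y) x‖ ≤ M)
    (hdt : ∀ x, ∀ t ∈ Ioo 0 T, DifferentiableAt ℝ (fun τ => s τ x) t)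
    (h0 : ∀ x, s 0 x = s₀ x)
    (hlim : ∀ ε > 0, ∃ δ > 0, ∀ t ∈ Ioo 0 T, t < δ → ∀ x, |s t x - s₀ x| ≤ ε) :
    ContinuousOn (fun q : EuclideanSpace ℝ (Fin n) × ℝ => s q.2 q.1) (univ ×ˢ Ico 0 T) := by
  refine continuousOn_prod_of_continuousOn_lipschitzOnWith
    (fun q : EuclideanSpace ℝ (Fin n) × ℝ => s q.2 q.1) (max M₀ M).toNNReal ?_ ?_
  · intro x _ t ht
    rcases eq_or_lt_of_le ht.1 with h | h
    · subst h
      rw [Metric.continuousWithinAt_iff]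
      intro ε hε
      obtain ⟨δ, hδ, H⟩ := hlim (ε / 2) (by linarith)
      refine ⟨δ, hδ, fun {t} ht htd => ?_⟩
      rcases eq_or_lt_of_le ht.1 with h | h
      · subst h; simpa using hε
      · rw [Real.dist_eq, sub_zero, abs_of_pos h] at htd
        have := H t ⟨h, ht.2⟩ htd x
        rw [Real.dist_eq]
        simp only [h0]
        linarith
    · exact (hdt x t ⟨h, ht.2⟩).continuousAt.continuousWithinAt
  · intro t ht
    refine LipschitzWith.lipschitzOnWith ?_
    rcases eq_or_lt_of_le ht.1 with h | h
    · subst h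
      have : (fun x => s 0 x) = s₀ := funext h0
      simp only [this]
      refine lipschitzWith_of_nnnorm_fderiv_le h₀ fun x => ?_
      rw [← NNReal.coe_le_coe, coe_nnnorm]
      exact (hM₀ x).trans ((le_max_left _ _).trans (Real.le_coe_toNNReal _))
    · refine lipschitzWith_of_nnnorm_fderiv_le (hd t ⟨h, ht.2⟩) fun x => ?_
      rw [← NNReal.coe_le_coe, coe_nnnorm]
      exact (hM t ⟨h, ht.2⟩ x).trans ((le_max_right _ _).trans (Real.le_coe_toNNReal _))

/-- **No formation of a new phase, multi-dimensional slab case.**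
For `N ≥ 2`, write `x = (x₁, x') ∈ ℝ × ℝ^{N-1}`. Given `T > 0`, `α > 0`, a non-negative
bounded measurable heat source `f`, and initial boundary graphs `s₀m < s₀p` of class `C²`
with bounded derivatives up to second order, there is no triple `(u, sm, sp)` such that
`sm, sp` are `C¹` in `t` and `C²` in `x'` on `(0,T)` with `sm < sp`, converge to `s₀m, s₀p`
in the uniform `C²` topology as `t ↓ 0`, with `s±, ∇s±, ∇²s±` bounded on `ℝ^{N-1} × (0,T)`
and `ṡ±` bounded on `ℝ^{N-1} × (δ,T)` for each `δ > 0`, and `u` is a non-negative bounded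
classical solution of `∂ₜu - Δu = f` on the moving slab `{sm(t,x') < x₁ < sp(t,x')}`,
continuous together with `∇u` up to the lateral boundary, with `u = 0` and `∂u/∂ν = -α`
on both boundary graphs (equivalently `∂_{x₁}u = α/√(1+|∇'sm|²)` on the lower and
`∂_{x₁}u = -α/√(1+|∇'sp|²)` on the upper graph), continuous up to `t = 0` with
`u(·,0) ≡ 0`.  Here `u₁, u₁₁` are the first and second `x₁`-derivatives and `Du', D2u'`
the first and second Fréchet derivatives of `u` in `x'`, so `Δu = u₁₁ + ∑ i, D2u' eᵢ eᵢ`. -/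
theorem no_new_phase_multi_dimensional_slab
    (N : ℕ) (hN : 2 ≤ N)
    (T α : ℝ) (hT : 0 < T) (hα : 0 < α)
    (f : ℝ → EuclideanSpace ℝ (Fin (N - 1)) → ℝ → ℝ)
    (hf_nonneg : ∀ (x₁ : ℝ) (x' : EuclideanSpace ℝ (Fin (N - 1))), ∀ t ∈ Ioo 0 T,
      0 ≤ f x₁ x' t)
    (hf_bdd : ∃ M : ℝ, ∀ (x₁ : ℝ) (x' : EuclideanSpace ℝ (Fin (N - 1))), ∀ t ∈ Ioo 0 T,
      f x₁ x' t ≤ M)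
    (hf_meas : Measurable fun p : ℝ × EuclideanSpace ℝ (Fin (N - 1)) × ℝ =>
      f p.1 p.2.1 p.2.2)
    (s₀m s₀p : EuclideanSpace ℝ (Fin (N - 1)) → ℝ)
    (hs₀m : ContDiff ℝ 2 s₀m) (hs₀p : ContDiff ℝ 2 s₀p)
    (hs₀m_bdd : ∃ M : ℝ, ∀ x' : EuclideanSpace ℝ (Fin (N - 1)),
      ‖fderiv ℝ s₀m x'‖ ≤ M ∧ ‖fderiv ℝ (fderiv ℝ s₀m) x'‖ ≤ M)
    (hs₀p_bdd : ∃ M : ℝ, ∀ x' : EuclideanSpace ℝ (Fin (N - 1)),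
      ‖fderiv ℝ s₀p x'‖ ≤ M ∧ ‖fderiv ℝ (fderiv ℝ s₀p) x'‖ ≤ M)
    (hs₀_lt : ∀ x' : EuclideanSpace ℝ (Fin (N - 1)), s₀m x' < s₀p x') :
    ¬ ∃ (u : ℝ → EuclideanSpace ℝ (Fin (N - 1)) → ℝ → ℝ)
        (sm sp : ℝ → EuclideanSpace ℝ (Fin (N - 1)) → ℝ)
        (u₁ u₁₁ : ℝ → EuclideanSpace ℝ (Fin (N - 1)) → ℝ → ℝ)
        (Du' : ℝ → EuclideanSpace ℝ (Fin (N - 1)) → ℝ →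
          (EuclideanSpace ℝ (Fin (N - 1)) →L[ℝ] ℝ))
        (D2u' : ℝ → EuclideanSpace ℝ (Fin (N - 1)) → ℝ →
          (EuclideanSpace ℝ (Fin (N - 1)) →L[ℝ] EuclideanSpace ℝ (Fin (N - 1)) →L[ℝ] ℝ)),
      -- sm, sp are C² in x' for each t ∈ (0,T)
      (∀ t ∈ Ioo 0 T, ContDiff ℝ 2 (fun x' => sm t x') ∧ ContDiff ℝ 2 (fun x' => sp t x')) ∧
      -- sm, sp are C¹ in t on (0,T)
      (∀ x' : EuclideanSpace ℝ (Fin (N - 1)), ∀ t ∈ Ioo 0 T,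
        DifferentiableAt ℝ (fun τ => sm τ x') t ∧ DifferentiableAt ℝ (fun τ => sp τ x') t) ∧
      (∀ x' : EuclideanSpace ℝ (Fin (N - 1)),
        ContinuousOn (deriv (fun τ => sm τ x')) (Ioo 0 T) ∧
        ContinuousOn (deriv (fun τ => sp τ x')) (Ioo 0 T)) ∧
      -- ordering sm < sp
      (∀ t ∈ Ioo 0 T, ∀ x' : EuclideanSpace ℝ (Fin (N - 1)), sm t x' < sp t x') ∧
      -- extension to t = 0 by the initial graphs
      (∀ x' : EuclideanSpace ℝ (Fin (N - 1)), sm 0 x' = s₀m x' ∧ sp 0 x' = s₀p x') ∧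
      -- sm(t,·) → s₀m and sp(t,·) → s₀p in the uniform C² topology as t ↓ 0
      (∀ ε > 0, ∃ δ > 0, ∀ t ∈ Ioo 0 T, t < δ →
        ∀ x' : EuclideanSpace ℝ (Fin (N - 1)),
          |sm t x' - s₀m x'| ≤ ε ∧
          ‖fderiv ℝ (fun y => sm t y) x' - fderiv ℝ s₀m x'‖ ≤ ε ∧
          ‖fderiv ℝ (fderiv ℝ (fun y => sm t y)) x' - fderiv ℝ (fderiv ℝ s₀m) x'‖ ≤ ε ∧
          |sp t x' - s₀p x'| ≤ ε ∧
          ‖fderiv ℝ (fun y => sp t y) x' - fderiv ℝ s₀p x'‖ ≤ ε ∧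
          ‖fderiv ℝ (fderiv ℝ (fun y => sp t y)) x' - fderiv ℝ (fderiv ℝ s₀p) x'‖ ≤ ε) ∧
      -- s±, ∇s±, ∇²s± bounded on ℝ^{N-1} × (0,T)
      (∃ M : ℝ, ∀ t ∈ Ioo 0 T, ∀ x' : EuclideanSpace ℝ (Fin (N - 1)),
        |sm t x'| ≤ M ∧ ‖fderiv ℝ (fun y => sm t y) x'‖ ≤ M ∧
        ‖fderiv ℝ (fderiv ℝ (fun y => sm t y)) x'‖ ≤ M ∧
        |sp t x'| ≤ M ∧ ‖fderiv ℝ (fun y => sp t y) x'‖ ≤ M ∧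
        ‖fderiv ℝ (fderiv ℝ (fun y => sp t y)) x'‖ ≤ M) ∧
      -- ṡ± bounded on ℝ^{N-1} × (δ,T) for each δ > 0
      (∀ δ ∈ Ioo 0 T, ∃ M : ℝ, ∀ t ∈ Ioo δ T, ∀ x' : EuclideanSpace ℝ (Fin (N - 1)),
        |deriv (fun τ => sm τ x') t| ≤ M ∧ |deriv (fun τ => sp τ x') t| ≤ M) ∧
      -- u is a classical solution of ∂ₜ u - Δu = f in the moving slab
      (∀ t ∈ Ioo 0 T, ∀ x' : EuclideanSpace ℝ (Fin (N - 1)), ∀ x₁ : ℝ,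
        sm t x' < x₁ → x₁ < sp t x' →
        HasDerivAt (fun ξ => u ξ x' t) (u₁ x₁ x' t) x₁ ∧
        HasDerivAt (fun ξ => u₁ ξ x' t) (u₁₁ x₁ x' t) x₁ ∧
        HasFDerivAt (fun y => u x₁ y t) (Du' x₁ x' t) x' ∧
        HasFDerivAt (fun y => Du' x₁ y t) (D2u' x₁ x' t) x' ∧
        HasDerivAt (fun τ => u x₁ x' τ)
          (u₁₁ x₁ x' t +
            (∑ i : Fin (N - 1),
              D2u' x₁ x' t (EuclideanSpace.single i (1 : ℝ))
                (EuclideanSpace.single i (1 : ℝ))) + f x₁ x' t) t) ∧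
      -- u is non-negative on the closed moving slab
      (∀ t ∈ Ioo 0 T, ∀ x' : EuclideanSpace ℝ (Fin (N - 1)), ∀ x₁ : ℝ,
        sm t x' ≤ x₁ → x₁ ≤ sp t x' → 0 ≤ u x₁ x' t) ∧
      -- u is bounded
      (∃ M : ℝ, ∀ t ∈ Ioo 0 T, ∀ x' : EuclideanSpace ℝ (Fin (N - 1)), ∀ x₁ : ℝ,
        sm t x' ≤ x₁ → x₁ ≤ sp t x' → u x₁ x' t ≤ M) ∧
      -- u is continuous up to the lateral boundary and up to t = 0
      ContinuousOn (fun p : ℝ × EuclideanSpace ℝ (Fin (N - 1)) × ℝ => u p.1 p.2.1 p.2.2)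
        {p : ℝ × EuclideanSpace ℝ (Fin (N - 1)) × ℝ |
          p.2.2 ∈ Ico 0 T ∧ sm p.2.2 p.2.1 ≤ p.1 ∧ p.1 ≤ sp p.2.2 p.2.1} ∧
      -- ∇u is continuous up to the lateral boundary
      ContinuousOn (fun p : ℝ × EuclideanSpace ℝ (Fin (N - 1)) × ℝ => u₁ p.1 p.2.1 p.2.2)
        {p : ℝ × EuclideanSpace ℝ (Fin (N - 1)) × ℝ |
          p.2.2 ∈ Ioo 0 T ∧ sm p.2.2 p.2.1 ≤ p.1 ∧ p.1 ≤ sp p.2.2 p.2.1} ∧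
      ContinuousOn (fun p : ℝ × EuclideanSpace ℝ (Fin (N - 1)) × ℝ => Du' p.1 p.2.1 p.2.2)
        {p : ℝ × EuclideanSpace ℝ (Fin (N - 1)) × ℝ |
          p.2.2 ∈ Ioo 0 T ∧ sm p.2.2 p.2.1 ≤ p.1 ∧ p.1 ≤ sp p.2.2 p.2.1} ∧
      -- Dirichlet boundary conditions on both graphs
      (∀ t ∈ Ioo 0 T, ∀ x' : EuclideanSpace ℝ (Fin (N - 1)),
        u (sm t x') x' t = 0 ∧ u (sp t x') x' t = 0) ∧
      -- exterior normal derivative conditions ∂u/∂ν = -α on both graphs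
      (∀ t ∈ Ioo 0 T, ∀ x' : EuclideanSpace ℝ (Fin (N - 1)),
        u₁ (sm t x') x' t = α / Real.sqrt (1 + ‖fderiv ℝ (fun y => sm t y) x'‖ ^ 2) ∧
        u₁ (sp t x') x' t = -α / Real.sqrt (1 + ‖fderiv ℝ (fun y => sp t y) x'‖ ^ 2)) ∧
      -- zero initial value on the initial slab
      (∀ x' : EuclideanSpace ℝ (Fin (N - 1)), ∀ x₁ : ℝ,
        s₀m x' ≤ x₁ → x₁ ≤ s₀p x' → u x₁ x' 0 = 0) := by
  rintro ⟨u, sm, sp, u₁, u₁₁, Du', D2u', hC2, hdt, -, hlt, hzero, hlim, ⟨Mb, hMb⟩, -, hsol, -,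
    ⟨Mu, hMu⟩, hu, hu₁, -, hD, hNm, hini⟩
  obtain ⟨M₁, hM₁⟩ := hf_bdd
  obtain ⟨Mm, hMm⟩ := hs₀m_bdd
  obtain ⟨Mp, hMp⟩ := hs₀p_bdd
  obtain ⟨n, rfl⟩ : ∃ n, n = N - 1 := ⟨_, rfl⟩
  generalize N - 1 = n at *
  set M : ℝ := max M₁ 1 with hMdef
  have hM1 : 1 ≤ M := le_max_right _ _
  have hf : ∀ (x₁ : ℝ) (x' : EuclideanSpace ℝ (Fin n)), ∀ t ∈ Ioo 0 T, f x₁ x' t ≤ M :=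
    fun x₁ x' t ht => (hM₁ x₁ x' t ht).trans (le_max_left _ _)
  have hsm := slab_graph_cont n T s₀m sm (hs₀m.differentiable (by norm_num)) Mm Mb
    (fun x => (hMm x).1) (fun t ht => (hC2 t ht).1.differentiable (by norm_num))
    (fun t ht x => (hMb t ht x).2.1) (fun x t ht => (hdt x t ht).1) (fun x => (hzero x).1)
    (fun ε hε => by
      obtain ⟨δ, hδ, H⟩ := hlim ε hε
      exact ⟨δ, hδ, fun t ht h x => (H t ht h x).1⟩)
  have hsp := slab_graph_cont n T s₀p sp (hs₀p.differentiable (by norm_num)) Mp Mb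
    (fun x => (hMp x).1) (fun t ht => (hC2 t ht).2.differentiable (by norm_num))
    (fun t ht x => (hMb t ht x).2.2.2.2.1) (fun x t ht => (hdt x t ht).2) (fun x => (hzero x).2)
    (fun ε hε => by
      obtain ⟨δ, hδ, H⟩ := hlim ε hε
      exact ⟨δ, hδ, fun t ht h x => (H t ht h x).2.2.2.1⟩)
  -- bounds for the graphs including `t = 0`
  have hbd : ∀ t ∈ Ico 0 T, ∀ x', |sm t x'| ≤ Mb + 1 ∧ |sp t x'| ≤ Mb + 1 := by
    intro t ht x
    rcases eq_or_lt_of_le ht.1 with h | h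
    · subst h
      obtain ⟨δ, hδ, H⟩ := hlim 1 one_pos
      have hmin : 0 < min δ T := lt_min hδ hT
      have h1 : min δ T / 2 ∈ Ioo 0 T := ⟨by linarith, by linarith [min_le_right δ T]⟩
      have h2 := H _ h1 (by linarith [min_le_left δ T]) x
      have h3 := hMb _ h1 x
      rw [(hzero x).1, (hzero x).2]
      have a1 := abs_le.1 h2.1
      have a2 := abs_le.1 h2.2.2.2.1
      have b1 := abs_le.1 h3.1
      have b2 := abs_le.1 h3.2.2.2.1
      exact ⟨abs_le.2 ⟨by linarith, by linarith⟩, abs_le.2 ⟨by linarith, by linarith⟩⟩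
    · have h3 := hMb t ⟨h, ht.2⟩ x
      exact ⟨by linarith [h3.1], by linarith [h3.2.2.2.1]⟩
  -- the slope
  have hMb0 : 0 ≤ Mb := by
    have := (hMb (T / 2) ⟨by linarith, by linarith⟩ 0).1
    exact (abs_nonneg _).trans this
  set κ : ℝ := α / Real.sqrt (1 + Mb ^ 2) / 2 with hκ
  have hκ0 : 0 < κ := by positivity
  have hlow : ∀ t ∈ Ioo 0 T, ∀ x', κ < u₁ (sm t x') x' t := by
    intro t ht x
    rw [(hNm t ht x).1]
    have h1 : Real.sqrt (1 + ‖fderiv ℝ (fun y => sm t y) x‖ ^ 2) ≤ Real.sqrt (1 + Mb ^ 2) :=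
      Real.sqrt_le_sqrt (by
        have := pow_le_pow_left₀ (norm_nonneg _) (hMb t ht x).2.1 2
        linarith)
    have h2 : α / Real.sqrt (1 + Mb ^ 2) ≤
        α / Real.sqrt (1 + ‖fderiv ℝ (fun y => sm t y) x‖ ^ 2) :=
      div_le_div_of_nonneg_left hα.le (Real.sqrt_pos.2 (by positivity)) h1
    linarith
  have hup : ∀ t ∈ Ioo 0 T, ∀ x', u₁ (sp t x') x' t < 0 := by
    intro t ht x
    rw [(hNm t ht x).2]
    exact div_neg_of_neg_of_pos (by linarith) (Real.sqrt_pos.2 (by positivity))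
  have hMu' : ∀ t ∈ Ico 0 T, ∀ x' : EuclideanSpace ℝ (Fin n), ∀ x₁ : ℝ,
      sm t x' ≤ x₁ → x₁ ≤ sp t x' → u x₁ x' t ≤ max Mu 0 := by
    intro t ht x x₁ h1 h2
    rcases eq_or_lt_of_le ht.1 with h | h
    · subst h
      rw [(hzero x).1] at h1
      rw [(hzero x).2] at h2
      rw [hini x x₁ h1 h2]
      exact le_max_right _ _
    · exact (hMu t ⟨h, ht.2⟩ x x₁ h1 h2).trans (le_max_left _ _)
  -- constants
  set B : ℝ := M + 2 * n * κ with hBdef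
  have hB0 : 0 < B := by positivity
  set c : ℝ := κ / (4 * (M + B)) with hc
  have hc0 : 0 < c := by positivity
  obtain ⟨δ, hδ, Hδ⟩ := hlim (c / 4) (by linarith)
  set t₀ : ℝ := min (min (δ / 4) (T / 4)) (c ^ 2 / 2) with ht₀
  have ht₀0 : 0 < t₀ := by positivity
  have ht₀δ : t₀ ≤ δ / 4 := (min_le_left _ _).trans (min_le_left _ _)
  have ht₀T : t₀ ≤ T / 4 := (min_le_left _ _).trans (min_le_right _ _)
  have ht₀c : t₀ ≤ c ^ 2 / 2 := min_le_right _ _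
  -- first step : `u ≤ M t`
  have hstep1 : ∀ (x' : EuclideanSpace ℝ (Fin n)) (x₁ : ℝ), sm t₀ x' ≤ x₁ → x₁ ≤ sp t₀ x' →
      u x₁ x' t₀ ≤ M * t₀ := by
    intro x x₁ h1 h2
    have := slab_mp n T 0 t₀ M (max Mu 0) κ 0 M 0 0 (-(Mb + 1)) le_rfl (by linarith)
      f u u₁ u₁₁ sm sp Du' D2u' hf hsm hsp hlt
      ⟨Mb + 1, fun t ht => hbd t ⟨ht.1, by linarith [ht.2]⟩⟩ hsol
      (fun t ht => hMu' t ⟨ht.1, by linarith [ht.2]⟩) hu hu₁ hlow hup le_rfl le_rfl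
      (by simpa using hκ0.le) (by linarith) (by simp)
      (fun t ht x => by
        have := abs_le.1 (hbd t ⟨ht.1, by linarith [ht.2]⟩ x).1
        have h3 : 0 ≤ ‖x‖ ^ 2 := by positivity
        linarith)
      (fun x x₁ h1 h2 => by
        rw [(hzero x).1] at h1
        rw [(hzero x).2] at h2
        rw [hini x x₁ h1 h2]
        simp)
      t₀ ⟨ht₀0.le, le_rfl⟩ x x₁ h1 h2
    simpa using this
  -- second step
  set V : ℝ := c / t₀ with hV
  have hV0 : 0 < V := by positivity
  have hVt : V * t₀ = c := by rw [hV]; field_simp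
  have hIco : ∀ t ∈ Icc t₀ (2 * t₀), t ∈ Ioo 0 T := fun t ht =>
    ⟨by linarith [ht.1], by linarith [ht.2]⟩
  set S : Set ℝ := {r | ∃ t ∈ Icc t₀ (2 * t₀), ∃ x' : EuclideanSpace ℝ (Fin n),
    r = sm t x' + ‖x'‖ ^ 2 - V * t} with hS
  have hSne : S.Nonempty := ⟨_, t₀, ⟨le_rfl, by linarith⟩, 0, rfl⟩
  have hSbd : BddBelow S := by
    refine ⟨-(Mb + 1) - V * (2 * t₀), ?_⟩
    rintro r ⟨t, ht, x, rfl⟩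
    have h1 := abs_le.1 (hbd t ⟨by linarith [ht.1], by linarith [ht.2]⟩ x).1
    have h2 : 0 ≤ ‖x‖ ^ 2 := by positivity
    have h3 := mul_le_mul_of_nonneg_left ht.2 hV0.le
    linarith
  set m : ℝ := sInf S with hm
  have hθ : ∀ t ∈ Icc t₀ (2 * t₀), ∀ x', m ≤ sm t x' + ‖x'‖ ^ 2 - V * t := fun t ht x =>
    csInf_le hSbd ⟨t, ht, x, rfl⟩
  obtain ⟨r, ⟨t₁, ht₁, y, rfl⟩, hr⟩ := exists_lt_of_csInf_lt hSne
    (show sInf S < m + 1 / (8 * V) by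
      have : 0 < 1 / (8 * V) := by positivity
      linarith)
  have hfin := slab_mp n T t₀ (2 * t₀) M (max Mu 0) κ (M * t₀ + κ / V / 2) B (κ / V) V m ht₀0.le
      (by linarith)
      f u u₁ u₁₁ sm sp Du' D2u' hf hsm hsp hlt
      ⟨Mb + 1, fun t ht => hbd t ⟨by linarith [ht.1], by linarith [ht.2]⟩⟩ hsol
      (fun t ht => hMu' t ⟨by linarith [ht.1], by linarith [ht.2]⟩) hu hu₁ hlow hup
      (by positivity) hV0.le
      (by rw [div_mul_cancel₀ _ hV0.ne']) hB0.le
      (by rw [div_mul_cancel₀ _ hV0.ne']) hθ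
      (fun x x₁ h1 h2 => by
        have h3 := hstep1 x x₁ h1 h2
        have h4 : c / 2 ≤ x₁ - V * t₀ + ‖x‖ ^ 2 - m := by
          have g1 := hθ (2 * t₀) ⟨by linarith, le_rfl⟩ x
          have g2 := abs_le.1 (Hδ t₀ ⟨ht₀0, by linarith⟩ (by linarith) x).1
          have g3 := abs_le.1 (Hδ (2 * t₀) ⟨by linarith, by linarith⟩ (by linarith) x).1
          linarith
        have h5 : (1 : ℝ) ≤ V * (x₁ - V * t₀ + ‖x‖ ^ 2 - m) := by
          have g1 := mul_le_mul_of_nonneg_left h4 hV0.le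
          have g2 : 1 ≤ V * (c / 2) := by
            rw [hV, div_mul_eq_mul_div, le_div_iff₀ ht₀0]
            linarith
          linarith
        have h6 : Real.exp (-V * (x₁ - V * t₀ + ‖x‖ ^ 2 - m)) ≤ 1 / 2 := by
          have g1 : Real.exp (-V * (x₁ - V * t₀ + ‖x‖ ^ 2 - m)) ≤ Real.exp (-1) :=
            Real.exp_le_exp.2 (by linarith)
          have g2 := Real.exp_neg_one_lt_half
          linarith
        have h7 := mul_le_mul_of_nonneg_left h6 (show 0 ≤ κ / V by positivity)
        linarith)
      t₁ ht₁ y (sm t₁ y) le_rfl (hlt t₁ (hIco t₁ ht₁) y).le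
  rw [(hD t₁ (hIco t₁ ht₁) y).1] at hfin
  have e1 : 7 / 8 ≤ Real.exp (-V * (sm t₁ y - V * t₁ + ‖y‖ ^ 2 - m)) := by
    have g1 : V * (sm t₁ y - V * t₁ + ‖y‖ ^ 2 - m) ≤ V * (1 / (8 * V)) :=
      mul_le_mul_of_nonneg_left (by linarith) hV0.le
    have g2 : V * (1 / (8 * V)) = 1 / 8 := by field_simp
    have g3 := Real.add_one_le_exp (-V * (sm t₁ y - V * t₁ + ‖y‖ ^ 2 - m))
    linarith
  have e2 := mul_le_mul_of_nonneg_left e1 (show 0 ≤ κ / V by positivity)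
  have e3 : B * (t₁ - t₀) ≤ B * t₀ := mul_le_mul_of_nonneg_left (by linarith [ht₁.2]) hB0.le
  have e4 : κ / V = 4 * (M + B) * t₀ := by
    have hMB : (M + B) ≠ 0 := by positivity
    rw [hV, hc]; field_simp
  have e5 : 0 < (M + B) * t₀ := by positivity
  rw [e4] at hfin e2
  linarith
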